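/- arXiv:1801.02926 — 5 statements merged into one kernel-verified Lean document; each statement's English description precedes it below -/
import Mathlib

section
/- Let L be a smooth map from an open set U ⊆ ℝⁿ to the n×n real matrices whose Haantjes torsion vanishes identically on U. Then for every m ∈ ℕ and all smooth functions a_0, …, a_m : U → ℝ, the operator field K(x) = Σ_{j=0}^m a_j(x) L(x)^j also has identically vanishing Haantjes torsion on U. -/
open Matrix BigOperators

/-- Partial derivative in the `α`-th coordinate direction. -/
noncomputable def pd {n : ℕ} (α : Fin n) (f : (Fin n → ℝ) → ℝ) (x : Fin n → ℝ) : ℝ :=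
  fderiv ℝ f x (Pi.single α 1)

/-- Components of the Nijenhuis torsion of a (1,1)-tensor field written in coordinates. -/
noncomputable def nijenhuisTorsion {n : ℕ} (L : (Fin n → ℝ) → Matrix (Fin n) (Fin n) ℝ)
    (x : Fin n → ℝ) (i j k : Fin n) : ℝ :=
  ∑ α, (pd α (fun y => L y i k) x * L x α j - pd α (fun y => L y i j) x * L x α k
    + (pd k (fun y => L y α j) x - pd j (fun y => L y α k) x) * L x i α)

/-- Components of the Haantjes torsion of a (1,1)-tensor field written in coordinates. -/
noncomputable def haantjesTorsion {n : ℕ} (L : (Fin n → ℝ) → Matrix (Fin n) (Fin n) ℝ)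
    (x : Fin n → ℝ) (i j k : Fin n) : ℝ :=
  ∑ α, ∑ β, (L x i α * L x α β * nijenhuisTorsion L x β j k
    + nijenhuisTorsion L x i α β * L x α j * L x β k
    - L x i α * (nijenhuisTorsion L x α β k * L x β j
        + nijenhuisTorsion L x α j β * L x β k))

/-- Contraction of the upper index of a (1,2)-tensor with `M`. -/
def upperAct {n : ℕ} (M : Matrix (Fin n) (Fin n) ℝ) :
    Module.End ℝ (Fin n → Fin n → Fin n → ℝ) where
  toFun T i j k := ∑ α, M i α * T α j k
  map_add' S T := by ext; simp [mul_add, Finset.sum_add_distrib]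
  map_smul' c T := by ext; simp [Finset.mul_sum, mul_left_comm]

/-- Contraction of the first lower index of a (1,2)-tensor with `M`. -/
def fstAct {n : ℕ} (M : Matrix (Fin n) (Fin n) ℝ) :
    Module.End ℝ (Fin n → Fin n → Fin n → ℝ) where
  toFun T i j k := ∑ α, T i α k * M α j
  map_add' S T := by ext; simp [add_mul, Finset.sum_add_distrib]
  map_smul' c T := by ext; simp [Finset.mul_sum, mul_assoc]

/-- Contraction of the second lower index of a (1,2)-tensor with `M`. -/
def sndAct {n : ℕ} (M : Matrix (Fin n) (Fin n) ℝ) :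
    Module.End ℝ (Fin n → Fin n → Fin n → ℝ) where
  toFun T i j k := ∑ α, T i j α * M α k
  map_add' S T := by ext; simp [add_mul, Finset.sum_add_distrib]
  map_smul' c T := by ext; simp [Finset.mul_sum, mul_assoc]

/-- Exchange of the two lower indices of a (1,2)-tensor. -/
def swapLower (n : ℕ) : Module.End ℝ (Fin n → Fin n → Fin n → ℝ) where
  toFun T i j k := T i k j
  map_add' _ _ := rfl
  map_smul' _ _ := rfl

section Actions

variable {n : ℕ} (M N : Matrix (Fin n) (Fin n) ℝ)

lemma upperAct_apply (T : Fin n → Fin n → Fin n → ℝ) (i j k : Fin n) :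
    upperAct M T i j k = ∑ α, M i α * T α j k := rfl

lemma fstAct_apply (T : Fin n → Fin n → Fin n → ℝ) (i j k : Fin n) :
    fstAct M T i j k = ∑ α, T i α k * M α j := rfl

lemma sndAct_apply (T : Fin n → Fin n → Fin n → ℝ) (i j k : Fin n) :
    sndAct M T i j k = ∑ α, T i j α * M α k := rfl

lemma swapLower_apply (T : Fin n → Fin n → Fin n → ℝ) (i j k : Fin n) :
    swapLower n T i j k = T i k j := rfl

lemma upperAct_one : upperAct (1 : Matrix (Fin n) (Fin n) ℝ) = 1 := by
  ext T i j k; simp [upperAct_apply, Matrix.one_apply]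

lemma fstAct_one : fstAct (1 : Matrix (Fin n) (Fin n) ℝ) = 1 := by
  ext T i j k; simp [fstAct_apply, Matrix.one_apply]

lemma sndAct_one : sndAct (1 : Matrix (Fin n) (Fin n) ℝ) = 1 := by
  ext T i j k; simp [sndAct_apply, Matrix.one_apply]

lemma upperAct_mul : upperAct (M * N) = upperAct M * upperAct N := by
  refine LinearMap.ext fun T => ?_
  ext i j k
  simp only [upperAct_apply, Module.End.mul_apply, Matrix.mul_apply, Finset.sum_mul,
    Finset.mul_sum]
  rw [Finset.sum_comm]
  simp only [mul_assoc]

lemma fstAct_mul : fstAct (M * N) = fstAct N * fstAct M := by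
  refine LinearMap.ext fun T => ?_
  ext i j k
  simp only [fstAct_apply, Module.End.mul_apply, Matrix.mul_apply, Finset.sum_mul,
    Finset.mul_sum]
  rw [Finset.sum_comm]
  simp only [mul_assoc]

lemma sndAct_mul : sndAct (M * N) = sndAct N * sndAct M := by
  refine LinearMap.ext fun T => ?_
  ext i j k
  simp only [sndAct_apply, Module.End.mul_apply, Matrix.mul_apply, Finset.sum_mul,
    Finset.mul_sum]
  rw [Finset.sum_comm]
  simp only [mul_assoc]

lemma upperAct_pow (p : ℕ) : upperAct (M ^ p) = upperAct M ^ p := by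
  induction p with
  | zero => simp [upperAct_one]
  | succ p ih => rw [pow_succ, pow_succ, upperAct_mul, ih]

lemma fstAct_pow (p : ℕ) : fstAct (M ^ p) = fstAct M ^ p := by
  induction p with
  | zero => simp [fstAct_one]
  | succ p ih => rw [pow_succ, pow_succ', fstAct_mul, ih]

lemma sndAct_pow (p : ℕ) : sndAct (M ^ p) = sndAct M ^ p := by
  induction p with
  | zero => simp [sndAct_one]
  | succ p ih => rw [pow_succ, pow_succ', sndAct_mul, ih]

lemma upperAct_sum_smul_pow (s : Finset ℕ) (c : ℕ → ℝ) :
    upperAct (∑ p ∈ s, c p • M ^ p) = ∑ p ∈ s, c p • upperAct M ^ p := by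
  simp_rw [← upperAct_pow]
  refine LinearMap.ext fun T => ?_
  ext i j k
  simp only [upperAct_apply, Matrix.sum_apply, LinearMap.sum_apply, Finset.sum_apply,
    Finset.sum_mul, LinearMap.smul_apply, Pi.smul_apply, Matrix.smul_apply, smul_eq_mul,
    Finset.mul_sum]
  rw [Finset.sum_comm]
  simp only [mul_assoc]

lemma fstAct_sum_smul_pow (s : Finset ℕ) (c : ℕ → ℝ) :
    fstAct (∑ p ∈ s, c p • M ^ p) = ∑ p ∈ s, c p • fstAct M ^ p := by
  simp_rw [← fstAct_pow]
  refine LinearMap.ext fun T => ?_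
  ext i j k
  simp only [fstAct_apply, Matrix.sum_apply, LinearMap.sum_apply, Finset.sum_apply,
    LinearMap.smul_apply, Pi.smul_apply, Matrix.smul_apply, smul_eq_mul, Finset.mul_sum]
  rw [Finset.sum_comm]
  simp only [mul_left_comm]

lemma sndAct_sum_smul_pow (s : Finset ℕ) (c : ℕ → ℝ) :
    sndAct (∑ p ∈ s, c p • M ^ p) = ∑ p ∈ s, c p • sndAct M ^ p := by
  simp_rw [← sndAct_pow]
  refine LinearMap.ext fun T => ?_
  ext i j k
  simp only [sndAct_apply, Matrix.sum_apply, LinearMap.sum_apply, Finset.sum_apply,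
    LinearMap.smul_apply, Pi.smul_apply, Matrix.smul_apply, smul_eq_mul, Finset.mul_sum]
  rw [Finset.sum_comm]
  simp only [mul_left_comm]

lemma commute_upperAct_fstAct : Commute (upperAct M) (fstAct N) := by
  refine LinearMap.ext fun T => ?_
  ext i j k
  simp only [upperAct_apply, fstAct_apply, Module.End.mul_apply, Finset.sum_mul, Finset.mul_sum]
  rw [Finset.sum_comm]
  simp only [mul_assoc]

lemma commute_upperAct_sndAct : Commute (upperAct M) (sndAct N) := by
  refine LinearMap.ext fun T => ?_
  ext i j k
  simp only [upperAct_apply, sndAct_apply, Module.End.mul_apply, Finset.sum_mul, Finset.mul_sum]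
  rw [Finset.sum_comm]
  simp only [mul_assoc]

lemma commute_fstAct_sndAct : Commute (fstAct M) (sndAct N) := by
  refine LinearMap.ext fun T => ?_
  ext i j k
  simp only [fstAct_apply, sndAct_apply, Module.End.mul_apply, Finset.sum_mul]
  rw [Finset.sum_comm]
  simp only [mul_right_comm]

lemma semiconjBy_swapLower_sndAct : SemiconjBy (swapLower n) (sndAct M) (fstAct M) := rfl

lemma semiconjBy_swapLower_upperAct : SemiconjBy (swapLower n) (upperAct M) (upperAct M) := rfl

end Actions

/-- The array of first partial derivatives of a matrix field, as a (1,2)-array. -/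
noncomputable def partials {n : ℕ} (L : (Fin n → ℝ) → Matrix (Fin n) (Fin n) ℝ)
    (x : Fin n → ℝ) : Fin n → Fin n → Fin n → ℝ :=
  fun i j k => pd j (fun y => L y i k) x

lemma nijenhuisTorsion_eq {n : ℕ} (L : (Fin n → ℝ) → Matrix (Fin n) (Fin n) ℝ)
    (x : Fin n → ℝ) :
    nijenhuisTorsion L x = (fstAct (L x) - upperAct (L x)) (partials L x)
      - (sndAct (L x) - upperAct (L x)) (swapLower n (partials L x)) := by
  ext i j k
  simp only [nijenhuisTorsion, LinearMap.sub_apply, Pi.sub_apply, upperAct_apply, fstAct_apply,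
    sndAct_apply, swapLower_apply, partials, ← Finset.sum_sub_distrib]
  exact Finset.sum_congr rfl fun α _ => by ring

lemma haantjesTorsion_eq {n : ℕ} (L : (Fin n → ℝ) → Matrix (Fin n) (Fin n) ℝ)
    (x : Fin n → ℝ) :
    haantjesTorsion L x = ((upperAct (L x) - fstAct (L x)) * (upperAct (L x) - sndAct (L x)))
      (nijenhuisTorsion L x) := by
  have h : (upperAct (L x) - fstAct (L x)) * (upperAct (L x) - sndAct (L x)) =
      upperAct (L x) * upperAct (L x) + sndAct (L x) * fstAct (L x)
        - (upperAct (L x) * fstAct (L x) + upperAct (L x) * sndAct (L x)) := by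
    rw [sub_mul, mul_sub, mul_sub, (commute_upperAct_fstAct _ _).eq,
      (commute_fstAct_sndAct _ _).eq]
    abel
  rw [h]
  ext i j k
  simp only [haantjesTorsion, LinearMap.sub_apply, LinearMap.add_apply, Pi.sub_apply,
    Pi.add_apply, Module.End.mul_apply, upperAct_apply, fstAct_apply, sndAct_apply,
    Finset.mul_sum, Finset.sum_mul, Finset.sum_sub_distrib, Finset.sum_add_distrib, mul_add]
  congr 1
  · congr 1
    · simp only [mul_assoc]
    · rw [Finset.sum_comm]

section Derivatives

variable {n : ℕ} {x : Fin n → ℝ}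

lemma pd_mul {f g : (Fin n → ℝ) → ℝ} (j : Fin n) (hf : DifferentiableAt ℝ f x)
    (hg : DifferentiableAt ℝ g x) :
    pd j (fun y => f y * g y) x = pd j f x * g x + f x * pd j g x := by
  simp [pd, fderiv_fun_mul hf hg, mul_comm, add_comm]

lemma pd_sum {ι : Type*} {s : Finset ι} {f : ι → (Fin n → ℝ) → ℝ} (j : Fin n)
    (hf : ∀ p ∈ s, DifferentiableAt ℝ (f p) x) :
    pd j (fun y => ∑ p ∈ s, f p y) x = ∑ p ∈ s, pd j (f p) x := by
  simp [pd, fderiv_fun_sum hf]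

variable {L : (Fin n → ℝ) → Matrix (Fin n) (Fin n) ℝ}

lemma differentiableAt_pow_entry (hL : ∀ i j, DifferentiableAt ℝ (fun y => L y i j) x) (p : ℕ)
    (i j : Fin n) : DifferentiableAt ℝ (fun y => (L y ^ p) i j) x := by
  induction p generalizing i j with
  | zero => simp
  | succ p ih =>
    simp only [pow_succ, Matrix.mul_apply]
    exact DifferentiableAt.fun_sum fun α _ => (ih i α).fun_mul (hL α j)

lemma partials_pow (hL : ∀ i j, DifferentiableAt ℝ (fun y => L y i j) x) (p : ℕ) :
    partials (fun y => L y ^ p) x =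
      (∑ r ∈ Finset.range p, upperAct (L x) ^ r * sndAct (L x) ^ (p - 1 - r)) (partials L x) := by
  induction p with
  | zero => ext i j k; simp [partials, pd]
  | succ p ih =>
    rw [Nat.add_sub_cancel, (commute_upperAct_sndAct _ _).geom_sum₂_succ_eq, LinearMap.add_apply,
      Module.End.mul_apply, ← ih, ← upperAct_pow]
    ext i j k
    have hd := differentiableAt_pow_entry hL p
    simp only [partials, pow_succ, Matrix.mul_apply, Pi.add_apply, upperAct_apply, sndAct_apply]
    rw [pd_sum j fun α _ => (hd i α).fun_mul (hL α k), ← Finset.sum_add_distrib]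
    exact Finset.sum_congr rfl fun α _ => by rw [pd_mul j (hd i α) (hL α k)]; ring

lemma partials_sum_smul_pow (hL : ∀ i j, DifferentiableAt ℝ (fun y => L y i j) x)
    {s : Finset ℕ} {a : ℕ → (Fin n → ℝ) → ℝ} (ha : ∀ p ∈ s, DifferentiableAt ℝ (a p) x) :
    partials (fun y => ∑ p ∈ s, a p y • L y ^ p) x =
      (fun i j k => ∑ p ∈ s, pd j (a p) x * (L x ^ p) i k) +
      (∑ p ∈ s, a p x • ∑ r ∈ Finset.range p,
        upperAct (L x) ^ r * sndAct (L x) ^ (p - 1 - r)) (partials L x) := by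
  have hd := differentiableAt_pow_entry hL
  simp only [LinearMap.sum_apply, LinearMap.smul_apply]
  simp only [← LinearMap.sum_apply, ← partials_pow hL]
  ext i j k
  simp only [partials, Matrix.sum_apply, Matrix.smul_apply, smul_eq_mul, Pi.add_apply,
    Finset.sum_apply, Pi.smul_apply]
  rw [pd_sum j fun p hp => (ha p hp).fun_mul (hd p i k), ← Finset.sum_add_distrib]
  exact Finset.sum_congr rfl fun p hp => pd_mul j (ha p hp) (hd p i k)

lemma upperAct_sub_sndAct_tensor_pow (M : Matrix (Fin n) (Fin n) ℝ) (s : Finset ℕ)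
    (d : ℕ → Fin n → ℝ) :
    (upperAct M - sndAct M) (fun i j k => ∑ p ∈ s, d p j * (M ^ p) i k) = 0 := by
  ext i j k
  simp only [LinearMap.sub_apply, Pi.sub_apply, upperAct_apply, sndAct_apply, Finset.mul_sum,
    Finset.sum_mul, Pi.zero_apply]
  rw [Finset.sum_comm, Finset.sum_comm (s := Finset.univ), sub_eq_zero]
  refine Finset.sum_congr rfl fun p _ => ?_
  have h := congrFun (congrFun (pow_mul_comm' M p) i) k
  simp only [Matrix.mul_apply] at h
  simp only [mul_assoc, mul_left_comm _ (d p j), ← Finset.mul_sum, h]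

end Derivatives

lemma sum_smul_pow_sub_sum_smul_pow {A : Type*} [CommRing A] [Algebra ℝ A] (v l : A)
    (s : Finset ℕ) (c : ℕ → ℝ) :
    ∑ p ∈ s, c p • v ^ p - ∑ p ∈ s, c p • l ^ p =
      (v - l) * ∑ p ∈ s, c p • ∑ r ∈ Finset.range p, v ^ r * l ^ (p - 1 - r) := by
  simp only [Finset.mul_sum, ← Finset.sum_sub_distrib, ← smul_sub, Finset.smul_sum]
  refine Finset.sum_congr rfl fun p _ => ?_
  rw [← (Commute.all v l).mul_geom_sum₂, Finset.mul_sum, Finset.smul_sum]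
  simp only [mul_smul_comm]

/-- The polynomial identity behind the theorem, over a commutative ring acting on a module:
`l`, `m`, `v` play the roles of the three contractions with a Haantjes operator. -/
lemma smul_eq_zero_of_haantjes {A W : Type*} [CommRing A] [Algebra ℝ A] [AddCommGroup W]
    [Module A W] (l m v : A) (s : Finset ℕ) (c : ℕ → ℝ) (B B' C C' : W)
    (hC : (v - m) • C = 0) (hC' : (v - l) • C' = 0)
    (hB : ((v - l) * (v - m)) • ((l - v) • B - (m - v) • B') = 0) :
    ((∑ p ∈ s, c p • v ^ p - ∑ p ∈ s, c p • l ^ p) *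
      (∑ p ∈ s, c p • v ^ p - ∑ p ∈ s, c p • m ^ p)) •
      ((∑ p ∈ s, c p • l ^ p - ∑ p ∈ s, c p • v ^ p) •
        (C + (∑ p ∈ s, c p • ∑ r ∈ Finset.range p, v ^ r * m ^ (p - 1 - r)) • B) -
      (∑ p ∈ s, c p • m ^ p - ∑ p ∈ s, c p • v ^ p) •
        (C' + (∑ p ∈ s, c p • ∑ r ∈ Finset.range p, v ^ r * l ^ (p - 1 - r)) • B')) = 0 := by
  have h₁ := sum_smul_pow_sub_sum_smul_pow v l s c
  have h₂ := sum_smul_pow_sub_sum_smul_pow v m s c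
  rw [← neg_sub (∑ p ∈ s, c p • v ^ p) (∑ p ∈ s, c p • l ^ p),
    ← neg_sub (∑ p ∈ s, c p • v ^ p) (∑ p ∈ s, c p • m ^ p), h₁, h₂]
  generalize (∑ p ∈ s, c p • ∑ r ∈ Finset.range p, v ^ r * l ^ (p - 1 - r)) = q
  generalize (∑ p ∈ s, c p • ∑ r ∈ Finset.range p, v ^ r * m ^ (p - 1 - r)) = r
  linear_combination (norm := module) (q ^ 2 * r ^ 2) • hB - ((v - l) ^ 2 * q ^ 2 * r) • hC +
    ((v - m) ^ 2 * q * r ^ 2) • hC'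

open scoped IsMulCommutative in
lemma exists_commRing_of_commute {E : Type} [Ring E] [Algebra ℝ E] {l m v : E}
    (hlm : Commute l m) (hvl : Commute v l) (hvm : Commute v m) :
    ∃ (A : Type) (_ : CommRing A) (_ : Algebra ℝ A) (φ : A →ₐ[ℝ] E) (l' m' v' : A),
      φ l' = l ∧ φ m' = m ∧ φ v' = v := by
  have hs : ∀ a ∈ ({l, m, v} : Set E), ∀ b ∈ ({l, m, v} : Set E), a * b = b * a := by
    rintro a (rfl | rfl | rfl) b (rfl | rfl | rfl) <;>
      first
      | rfl
      | exact hlm.eq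
      | exact hvl.eq
      | exact hvm.eq
      | exact hlm.eq.symm
      | exact hvl.eq.symm
      | exact hvm.eq.symm
  have := Algebra.isMulCommutative_adjoin ℝ hs
  refine ⟨Algebra.adjoin ℝ {l, m, v}, inferInstance, inferInstance, Subalgebra.val _,
    ⟨l, Algebra.subset_adjoin (by simp)⟩, ⟨m, Algebra.subset_adjoin (by simp)⟩,
    ⟨v, Algebra.subset_adjoin (by simp)⟩, rfl, rfl, rfl⟩

lemma apply_eq_zero_of_haantjes {W : Type} [AddCommGroup W] [Module ℝ W]
    {l m v : Module.End ℝ W} (hlm : Commute l m) (hvl : Commute v l) (hvm : Commute v m)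
    (s : Finset ℕ) (c : ℕ → ℝ) (B B' C C' : W) (hC : (v - m) C = 0) (hC' : (v - l) C' = 0)
    (hB : ((v - l) * (v - m)) ((l - v) B - (m - v) B') = 0) :
    ((∑ p ∈ s, c p • v ^ p - ∑ p ∈ s, c p • l ^ p) *
      (∑ p ∈ s, c p • v ^ p - ∑ p ∈ s, c p • m ^ p))
      ((∑ p ∈ s, c p • l ^ p - ∑ p ∈ s, c p • v ^ p)
        (C + (∑ p ∈ s, c p • ∑ r ∈ Finset.range p, v ^ r * m ^ (p - 1 - r)) B) -
      (∑ p ∈ s, c p • m ^ p - ∑ p ∈ s, c p • v ^ p)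
        (C' + (∑ p ∈ s, c p • ∑ r ∈ Finset.range p, v ^ r * l ^ (p - 1 - r)) B')) = 0 := by
  obtain ⟨A, _, _, φ, l, m, v, rfl, rfl, rfl⟩ := exists_commRing_of_commute hlm hvl hvm
  let : Module A W := Module.compHom W (φ : A →+* Module.End ℝ W)
  have hφ (b : A) (w : W) : b • w = φ b w := rfl
  simp only [← map_sub, ← map_mul] at hC hC' hB
  have h := smul_eq_zero_of_haantjes l m v s c B B' C C' hC hC' hB
  simpa only [hφ, map_sub, map_mul, map_sum, map_smul, map_pow] using h

lemma swapLower_geom_sum {n : ℕ} (M : Matrix (Fin n) (Fin n) ℝ) (s : Finset ℕ) (c : ℕ → ℝ)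
    (T : Fin n → Fin n → Fin n → ℝ) :
    swapLower n ((∑ p ∈ s, c p • ∑ r ∈ Finset.range p,
      upperAct M ^ r * sndAct M ^ (p - 1 - r)) T) =
      (∑ p ∈ s, c p • ∑ r ∈ Finset.range p,
        upperAct M ^ r * fstAct M ^ (p - 1 - r)) (swapLower n T) := by
  simp only [← Module.End.mul_apply]
  congr 1
  simp only [Finset.mul_sum, Finset.sum_mul, mul_smul_comm, smul_mul_assoc]
  refine Finset.sum_congr rfl fun p _ => congrArg _ (Finset.sum_congr rfl fun r _ => ?_)
  exact ((semiconjBy_swapLower_upperAct M).pow_right r).mul_right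
    ((semiconjBy_swapLower_sndAct M).pow_right _)

/-- Any polynomial (with smooth function coefficients) in a Haantjes operator is again a
Haantjes operator. -/
theorem haantjes_of_polynomial {n : ℕ} (U : Set (Fin n → ℝ)) (hU : IsOpen U)
    (L : (Fin n → ℝ) → Matrix (Fin n) (Fin n) ℝ)
    (hL : ∀ i j : Fin n, ContDiffOn ℝ (⊤ : ℕ∞) (fun x => L x i j) U)
    (hHL : ∀ x ∈ U, ∀ i j k : Fin n, haantjesTorsion L x i j k = 0)
    (m : ℕ) (a : ℕ → (Fin n → ℝ) → ℝ)
    (ha : ∀ j ≤ m, ContDiffOn ℝ (⊤ : ℕ∞) (a j) U) :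
    ∀ x ∈ U, ∀ i j k : Fin n,
      haantjesTorsion (fun y => ∑ p ∈ Finset.range (m + 1), a p y • (L y) ^ p) x i j k = 0 := by
  intro x hx i j k
  have hd (i j : Fin n) : DifferentiableAt ℝ (fun y => L y i j) x :=
    ((hL i j).contDiffAt (hU.mem_nhds hx)).differentiableAt (by simp)
  have had : ∀ p ∈ Finset.range (m + 1), DifferentiableAt ℝ (a p) x := fun p hp =>
    ((ha p (Finset.mem_range_succ_iff.mp hp)).contDiffAt (hU.mem_nhds hx)).differentiableAt
      (by simp)
  have hH : haantjesTorsion L x = 0 := by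
    ext i j k
    exact hHL x hx i j k
  rw [haantjesTorsion_eq, nijenhuisTorsion_eq] at hH
  have hC := upperAct_sub_sndAct_tensor_pow (L x) (Finset.range (m + 1)) fun p j => pd j (a p) x
  have hC' := congrArg (swapLower n) hC
  rw [map_zero] at hC'
  refine congrFun (congrFun (congrFun (?_ : haantjesTorsion _ x = 0) i) j) k
  rw [haantjesTorsion_eq, nijenhuisTorsion_eq, partials_sum_smul_pow hd had, map_add (swapLower n),
    swapLower_geom_sum, upperAct_sum_smul_pow, fstAct_sum_smul_pow, sndAct_sum_smul_pow]
  exact apply_eq_zero_of_haantjes (commute_fstAct_sndAct _ _) (commute_upperAct_fstAct _ _)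
    (commute_upperAct_sndAct _ _) _ _ _ _ _ _ hC hC' hH
end

section
/- Let U ⊆ ℝⁿ be open, P : U → Matrix (Fin n) (Fin n) ℝ a map with P(x) skew-symmetric for all x, and K₁, K₂ : U → Matrix (Fin n) (Fin n) ℝ maps satisfying, at every x ∈ U, K₁(x)·P(x) = P(x)·K₁(x)ᵀ, K₂(x)·P(x) = P(x)·K₂(x)ᵀ and K₁(x)·K₂(x) = K₂(x)·K₁(x). Suppose H, H₁, H₂ : U → ℝ are differentiable functions whose gradients satisfy the Magri–Haantjes chain relations ∇H₁(x) = K₁(x)ᵀ·∇H(x) and ∇H₂(x) = K₂(x)ᵀ·∇H(x) for all x ∈ U. Then H₁ and H₂ are in involution with respect to the Poisson bracket defined by P: {H₁, H₂}(x) := ⟨∇H₁(x), P(x)·∇H₂(x)⟩ = 0 for every x ∈ U. -/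
open Matrix BigOperators

/-- The gradient of a function on `ℝⁿ`, as the vector of partial derivatives. -/
noncomputable def grad {n : ℕ} (H : (Fin n → ℝ) → ℝ) (x : Fin n → ℝ) : Fin n → ℝ :=
  fun i => fderiv ℝ H x (Pi.single i 1)

/-- The quadratic form of a skew-symmetric real matrix vanishes. -/
theorem dotProduct_mulVec_self_eq_zero_of_transpose_eq_neg {ι : Type*} [Fintype ι]
    {M : Matrix ι ι ℝ} (hM : Mᵀ = -M) (v : ι → ℝ) : v ⬝ᵥ (M *ᵥ v) = 0 := by
  have h : v ⬝ᵥ (M *ᵥ v) = -(v ⬝ᵥ (M *ᵥ v)) := by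
    conv_lhs => rw [dotProduct_mulVec, dotProduct_comm, ← mulVec_transpose, hM, neg_mulVec,
      dotProduct_neg]
  linarith

/-- If `A` and `B` commute and are compatible with the skew-symmetric matrix `P`, then
`A * P * Bᵀ` is skew-symmetric. -/
theorem transpose_mul_mul_transpose_eq_neg {ι : Type*} [Fintype ι] {P A B : Matrix ι ι ℝ}
    (hP : Pᵀ = -P) (hA : A * P = P * Aᵀ) (hB : B * P = P * Bᵀ) (hAB : A * B = B * A) :
    (A * P * Bᵀ)ᵀ = -(A * P * Bᵀ) := by
  rw [transpose_mul, transpose_mul, transpose_transpose, hP, Matrix.neg_mul, Matrix.mul_neg,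
    ← hA, Matrix.mul_assoc A, ← hB, ← Matrix.mul_assoc, ← Matrix.mul_assoc, hAB]

/-- Functions belonging to Magri–Haantjes chains generated by a single function are in
involution w.r.t. the Poisson bracket defined by `P`. -/
theorem magri_haantjes_involution {n : ℕ} (U : Set (Fin n → ℝ)) (hU : IsOpen U)
    (P K₁ K₂ : (Fin n → ℝ) → Matrix (Fin n) (Fin n) ℝ)
    (hP : ∀ x ∈ U, (P x)ᵀ = -P x)
    (h₁ : ∀ x ∈ U, K₁ x * P x = P x * (K₁ x)ᵀ)
    (h₂ : ∀ x ∈ U, K₂ x * P x = P x * (K₂ x)ᵀ)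
    (hcomm : ∀ x ∈ U, K₁ x * K₂ x = K₂ x * K₁ x)
    (H H₁ H₂ : (Fin n → ℝ) → ℝ)
    (hH : DifferentiableOn ℝ H U)
    (hH₁ : DifferentiableOn ℝ H₁ U)
    (hH₂ : DifferentiableOn ℝ H₂ U)
    (hchain₁ : ∀ x ∈ U, grad H₁ x = (K₁ x)ᵀ *ᵥ grad H x)
    (hchain₂ : ∀ x ∈ U, grad H₂ x = (K₂ x)ᵀ *ᵥ grad H x) :
    ∀ x ∈ U, ∑ i, grad H₁ x i * (P x *ᵥ grad H₂ x) i = 0 := by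
  intro x hx
  change grad H₁ x ⬝ᵥ (P x *ᵥ grad H₂ x) = 0
  rw [hchain₁ x hx, hchain₂ x hx, mulVec_transpose, ← dotProduct_mulVec, mulVec_mulVec,
    mulVec_mulVec]
  exact dotProduct_mulVec_self_eq_zero_of_transpose_eq_neg
    (transpose_mul_mul_transpose_eq_neg (hP x hx) (h₁ x hx) (h₂ x hx) (hcomm x hx)) _
end

section
/- Let c ≠ 0 be a real constant. The bivector field P₂ on ℝ⁶ (coordinates m = (ω₁, ω₂, ω₃, γ₁, γ₂, γ₃)), given in 3×3 block form by P₂ = [[T, R], [−Rᵀ, 0]] with T = [[0, −c ω₃, ω₂/c], [c ω₃, 0, −ω₁/c], [−ω₂/c, ω₁/c, 0]] and R = [[0, −γ₃, γ₂], [γ₃, 0, −γ₁], [−γ₂/c, γ₁/c, 0]], is a Poisson bivector: its components satisfy the Jacobi identity Σ_{α=1}^6 ( P₂^{α i} ∂_α P₂^{jk} + P₂^{α j} ∂_α P₂^{k i} + P₂^{α k} ∂_α P₂^{i j} ) = 0 at every point of ℝ⁶ and for all indices i, j, k. -/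
open Matrix BigOperators

/-- The third Poisson bivector `P₂ = [[T, R], [−Rᵀ, 0]]` of the Lagrange top, on `ℝ⁶`
with coordinates `m = (ω₁, ω₂, ω₃, γ₁, γ₂, γ₃)`. -/
noncomputable def P₂ (c : ℝ) (m : Fin 6 → ℝ) : Matrix (Fin 6) (Fin 6) ℝ :=
  !![0,        -c * m 2,  m 1 / c,   0,        -m 5,      m 4;
     c * m 2,  0,         -m 0 / c,  m 5,      0,         -m 3;
     -m 1 / c, m 0 / c,   0,         -m 4 / c, m 3 / c,   0;
     0,        -m 5,      m 4 / c,   0,        0,         0;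
     m 5,      0,         -m 3 / c,  0,        0,         0;
     -m 4,     m 3,       0,         0,        0,         0]

/-- The entries of `P₂` are linear in the coordinates. -/
theorem isLinearMap_P₂_apply (c : ℝ) (j k : Fin 6) :
    IsLinearMap ℝ (fun y => P₂ c y j k) := by
  constructor
  · intro x y
    fin_cases j <;> fin_cases k <;> simp [P₂] <;> ring
  · intro a x
    fin_cases j <;> fin_cases k <;> simp [P₂] <;> ring

theorem pd_of_isLinearMap {n : ℕ} {f : (Fin n → ℝ) → ℝ} (hf : IsLinearMap ℝ f) (α : Fin n)
    (x : Fin n → ℝ) : pd α f x = f (Pi.single α 1) :=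
  congrArg (fun L : (Fin n → ℝ) →L[ℝ] ℝ => L (Pi.single α 1))
    (LinearMap.toContinuousLinearMap hf.mk').fderiv

theorem P₂_apply_swap (c : ℝ) (m : Fin 6 → ℝ) (i j : Fin 6) : P₂ c m j i = -P₂ c m i j := by
  fin_cases i <;> fin_cases j <;> simp [P₂] <;> ring

/-- The Jacobiator of `P₂`, with the partial derivatives written as structure constants. -/
noncomputable def jacobiatorP₂ (c : ℝ) (m : Fin 6 → ℝ) (i j k : Fin 6) : ℝ :=
  ∑ α, (P₂ c m α i * P₂ c (Pi.single α 1) j k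
    + P₂ c m α j * P₂ c (Pi.single α 1) k i
    + P₂ c m α k * P₂ c (Pi.single α 1) i j)

theorem jacobiatorP₂_rotate (c : ℝ) (m : Fin 6 → ℝ) (i j k : Fin 6) :
    jacobiatorP₂ c m j k i = jacobiatorP₂ c m i j k :=
  Finset.sum_congr rfl fun _ _ => by ring

theorem jacobiatorP₂_swap (c : ℝ) (m : Fin 6 → ℝ) (i j k : Fin 6) :
    jacobiatorP₂ c m j i k = -jacobiatorP₂ c m i j k := by
  unfold jacobiatorP₂
  rw [← Finset.sum_neg_distrib]
  refine Finset.sum_congr rfl fun α _ => ?_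
  rw [P₂_apply_swap c _ k i, P₂_apply_swap c _ j k, P₂_apply_swap c _ i j]
  ring

set_option maxHeartbeats 1000000 in
theorem jacobiatorP₂_eq_zero_of_lt {c : ℝ} (hc : c ≠ 0) (m : Fin 6 → ℝ) {i j k : Fin 6}
    (hij : i < j) (hjk : j < k) : jacobiatorP₂ c m i j k = 0 := by
  rw [jacobiatorP₂, Fin.sum_univ_six]
  fin_cases i <;> fin_cases j <;> first
    | exact absurd hij (by decide)
    | (fin_cases k <;> first
        | exact absurd hjk (by decide)
        | (simp [P₂] <;> field_simp <;> ring))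

theorem jacobiatorP₂_eq_zero {c : ℝ} (hc : c ≠ 0) (m : Fin 6 → ℝ) (i j k : Fin 6) :
    jacobiatorP₂ c m i j k = 0 := by
  have diag (a b : Fin 6) : jacobiatorP₂ c m a a b = 0 := by
    linarith [jacobiatorP₂_swap c m a a b]
  have lt {a b d : Fin 6} : a < b → b < d → jacobiatorP₂ c m a b d = 0 :=
    jacobiatorP₂_eq_zero_of_lt hc m
  have r₁ := jacobiatorP₂_rotate c m i j k
  have r₂ := jacobiatorP₂_rotate c m j k i
  have s₁ := jacobiatorP₂_swap c m i j k
  have s₂ := jacobiatorP₂_swap c m j k i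
  have s₃ := jacobiatorP₂_swap c m k i j
  rcases lt_trichotomy i j with h | rfl | h
  · rcases lt_trichotomy j k with h' | rfl | h'
    · exact lt h h'
    · linarith [diag j i]
    · rcases lt_trichotomy i k with h'' | rfl | h''
      · linarith [lt h'' h']
      · linarith [diag i j]
      · linarith [lt h'' h]
  · exact diag i k
  · rcases lt_trichotomy j k with h' | rfl | h'
    · rcases lt_trichotomy i k with h'' | rfl | h''
      · linarith [lt h h'']
      · linarith [diag i j]
      · linarith [lt h' h'']
    · linarith [diag j i]
    · linarith [lt h' h]

/-- `P₂` is a Poisson bivector: its components satisfy the Jacobi identity. -/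
theorem P₂_jacobi (c : ℝ) (hc : c ≠ 0) :
    ∀ (m : Fin 6 → ℝ) (i j k : Fin 6),
      ∑ α, (P₂ c m α i * pd α (fun y => P₂ c y j k) m
        + P₂ c m α j * pd α (fun y => P₂ c y k i) m
        + P₂ c m α k * pd α (fun y => P₂ c y i j) m) = 0 := by
  intro m i j k
  simp only [pd_of_isLinearMap (isLinearMap_P₂_apply c _ _)]
  exact jacobiatorP₂_eq_zero hc m i j k
end

section
/- Let c be a real constant. Define on ℝ⁶ (coordinates m = (ω₁, ω₂, ω₃, γ₁, γ₂, γ₃)) the bivector fields P₀ = [[0, B], [B, C]] and P₁ = [[−B, 0], [0, Γ]] in 3×3 block form, where B = [[0, −1, 0], [1, 0, 0], [0, 0, 0]], C = [[0, c ω₃, −ω₂], [−c ω₃, 0, ω₁], [ω₂, −ω₁, 0]], Γ = [[0, γ₃, −γ₂], [−γ₃, 0, γ₁], [γ₂, −γ₁, 0]]. Then for every λ ∈ ℝ, the pencil P₀ − λ P₁ is a Poisson bivector: its components satisfy the Jacobi identity Σ_{α=1}^6 ( (P₀−λP₁)^{α i} ∂_α (P₀−λP₁)^{jk} + (P₀−λP₁)^{α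 j} ∂_α (P₀−λP₁)^{k i} + (P₀−λP₁)^{α k} ∂_α (P₀−λP₁)^{i j} ) = 0 at every point of ℝ⁶ and for all indices i, j, k. -/
open Matrix BigOperators

/-- The Poisson bivector `P₀ = [[0, B], [B, C]]` of the Lagrange top, on `ℝ⁶` with
coordinates `m = (ω₁, ω₂, ω₃, γ₁, γ₂, γ₃)`. -/
noncomputable def P₀ (c : ℝ) (m : Fin 6 → ℝ) : Matrix (Fin 6) (Fin 6) ℝ :=
  !![0,  0,  0,  0,        -1,        0;
     0,  0,  0,  1,        0,         0;
     0,  0,  0,  0,        0,         0;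
     0,  -1, 0,  0,        c * m 2,   -m 1;
     1,  0,  0,  -c * m 2, 0,         m 0;
     0,  0,  0,  m 1,      -m 0,      0]

/-- The Poisson bivector `P₁ = [[−B, 0], [0, Γ]]` of the Lagrange top. -/
noncomputable def P₁ (m : Fin 6 → ℝ) : Matrix (Fin 6) (Fin 6) ℝ :=
  !![0,  1,  0,  0,     0,     0;
     -1, 0,  0,  0,     0,     0;
     0,  0,  0,  0,     0,     0;
     0,  0,  0,  0,     m 5,   -m 4;
     0,  0,  0,  -m 5,  0,     m 3;
     0,  0,  0,  m 4,   -m 3,  0]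

/-- The derivative of an affine function along a vector is its linear part. -/
lemma sum_mul_pd_of_affine {n : ℕ} {f : (Fin n → ℝ) → ℝ} (L : (Fin n → ℝ) →ₗ[ℝ] ℝ) (b : ℝ)
    (hf : ∀ y, f y = L y + b) (v x : Fin n → ℝ) :
    ∑ α, v α * pd α f x = L v := by
  have hd : HasFDerivAt f (LinearMap.toContinuousLinearMap L) x :=
    ((LinearMap.toContinuousLinearMap L).hasFDerivAt.add_const b).congr_of_eventuallyEq
      (.of_forall hf)
  have hs (α : Fin n) : (fun j => if α = j then (1 : ℝ) else 0) = Pi.single α 1 := by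
    ext j
    simp [Pi.single_apply, eq_comm]
  have hv := L.pi_apply_eq_sum_univ v
  simp only [hs] at hv
  simpa [pd, hd.fderiv] using hv.symm

/-- The part of `P₀ − λ P₁` which is linear in the coordinates. -/
def pencilLinear (c lam : ℝ) (m : Fin 6 → ℝ) : Matrix (Fin 6) (Fin 6) ℝ :=
  !![0, 0, 0, 0, 0, 0;
     0, 0, 0, 0, 0, 0;
     0, 0, 0, 0, 0, 0;
     0, 0, 0, 0, c * m 2 - lam * m 5, lam * m 4 - m 1;
     0, 0, 0, lam * m 5 - c * m 2, 0, m 0 - lam * m 3;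
     0, 0, 0, m 1 - lam * m 4, lam * m 3 - m 0, 0]

/-- The part of `P₀ − λ P₁` which does not depend on the coordinates. -/
def pencilConst (lam : ℝ) : Matrix (Fin 6) (Fin 6) ℝ :=
  !![0, -lam, 0, 0, -1, 0;
     lam, 0, 0, 1, 0, 0;
     0, 0, 0, 0, 0, 0;
     0, -1, 0, 0, 0, 0;
     1, 0, 0, 0, 0, 0;
     0, 0, 0, 0, 0, 0]

lemma P₀_sub_smul_P₁ (c lam : ℝ) (m : Fin 6 → ℝ) :
    P₀ c m - lam • P₁ m = pencilLinear c lam m + pencilConst lam := by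
  ext j k
  fin_cases j <;> fin_cases k <;> simp [P₀, P₁, pencilLinear, pencilConst] <;> ring

lemma isLinearMap_pencilLinear (c lam : ℝ) (j k : Fin 6) :
    IsLinearMap ℝ fun m => pencilLinear c lam m j k := by
  constructor
  · intro x y
    fin_cases j <;> fin_cases k <;> simp [pencilLinear] <;> ring
  · intro a x
    fin_cases j <;> fin_cases k <;> simp [pencilLinear] <;> ring

/-- The derivative of an entry of the pencil along a vector. -/
lemma sum_mul_pd_pencil (c lam : ℝ) (v m : Fin 6 → ℝ) (j k : Fin 6) :
    ∑ α, v α * pd α (fun y => (P₀ c y - lam • P₁ y) j k) m = pencilLinear c lam v j k :=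
  sum_mul_pd_of_affine (isLinearMap_pencilLinear c lam j k).mk' (pencilConst lam j k)
    (fun y => by rw [P₀_sub_smul_P₁]; rfl) v m

set_option maxHeartbeats 1000000 in
/-- The pencil `P₀ − λ P₁` is a Poisson bivector for every `λ`: its components satisfy
the Jacobi identity. -/
theorem pencil_P₀_P₁_jacobi (c : ℝ) :
    ∀ (lam : ℝ) (m : Fin 6 → ℝ) (i j k : Fin 6),
      ∑ α, ((P₀ c m - lam • P₁ m) α i * pd α (fun y => (P₀ c y - lam • P₁ y) j k) m
        + (P₀ c m - lam • P₁ m) α j * pd α (fun y => (P₀ c y - lam • P₁ y) k i) m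
        + (P₀ c m - lam • P₁ m) α k * pd α (fun y => (P₀ c y - lam • P₁ y) i j) m) = 0 := by
  intro lam m i j k
  have h (i j k : Fin 6) := sum_mul_pd_pencil c lam (fun α => (P₀ c m - lam • P₁ m) α i) m j k
  simp only [Finset.sum_add_distrib, h]
  simp only [P₀_sub_smul_P₁]
  fin_cases i <;> fin_cases j <;> fin_cases k <;> simp [pencilLinear, pencilConst] <;> ring
end

section
/- Let c ≠ 0 be a real constant. Define on ℝ⁶ (coordinates m = (ω₁, ω₂, ω₃, γ₁, γ₂, γ₃)) the bivector fields P₁ = [[−B, 0], [0, Γ]] and P₂ = [[T, R], [−Rᵀ, 0]] in 3×3 block form, where B = [[0, −1, 0], [1, 0, 0], [0, 0, 0]], Γ = [[0, γ₃, −γ₂], [−γ₃, 0, γ₁], [γ₂, −γ₁, 0]], T = [[0, −c ω₃, ω₂/c], [c ω₃, 0, −ω₁/c], [−ω₂/c, ω₁/c, 0]], R = [[0, −γ₃, γ₂], [γ₃, 0, −γ₁], [−γ₂/c, γ₁/c, 0]]. Then for every λ ∈ ℝ, the pencil P₁ − λ P₂ is a Poisson bivector: its components satisfy the Jacobi identity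 Σ_{α=1}^6 ( (P₁−λP₂)^{α i} ∂_α (P₁−λP₂)^{jk} + (P₁−λP₂)^{α j} ∂_α (P₁−λP₂)^{k i} + (P₁−λP₂)^{α k} ∂_α (P₁−λP₂)^{i j} ) = 0 at every point of ℝ⁶ and for all indices i, j, k. -/
open Matrix BigOperators

theorem pd_affine {n : ℕ} (a : ℝ) (b : Fin n → ℝ) (α : Fin n) (x : Fin n → ℝ) :
    pd α (fun y => a + ∑ β, b β * y β) x = b α := by
  have h : HasFDerivAt (fun y : Fin n → ℝ => a + ∑ β, b β * y β)
      (∑ β, b β • ContinuousLinearMap.proj (R := ℝ) (φ := fun _ : Fin n => ℝ) β) x :=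
    (HasFDerivAt.fun_sum fun β _ => (hasFDerivAt_apply β x).const_mul (b β)).const_add a
  rw [pd, h.fderiv]
  simp [Pi.single_apply]

/-- The entries of `P₁ − λ P₂` are affine functions of the coordinates. -/
theorem pencil_apply_eq (c lam : ℝ) (y : Fin 6 → ℝ) (j k : Fin 6) :
    (P₁ y - lam • P₂ c y) j k = (P₁ 0 - lam • P₂ c 0) j k +
      ∑ β, ((P₁ (Pi.single β 1) - lam • P₂ c (Pi.single β 1)) j k
        - (P₁ 0 - lam • P₂ c 0) j k) * y β := by
  fin_cases j <;> fin_cases k <;>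
    simp [P₁, P₂, Fin.sum_univ_six, Pi.single_apply] <;> ring

theorem pd_pencil (c lam : ℝ) (m : Fin 6 → ℝ) (α j k : Fin 6) :
    pd α (fun y => (P₁ y - lam • P₂ c y) j k) m =
      (P₁ (Pi.single α 1) - lam • P₂ c (Pi.single α 1)) j k - (P₁ 0 - lam • P₂ c 0) j k := by
  rw [funext fun y => pencil_apply_eq c lam y j k, pd_affine]

theorem pencil_skew (c lam : ℝ) (y : Fin 6 → ℝ) (j k : Fin 6) :
    (P₁ y - lam • P₂ c y) j k = -(P₁ y - lam • P₂ c y) k j := by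
  fin_cases j <;> fin_cases k <;> simp [P₁, P₂] <;> ring

/-- A function of three indices vanishes if it is alternating and vanishes on increasing triples. -/
theorem eq_zero_of_alternating {ι : Type*} [LinearOrder ι] (J : ι → ι → ι → ℝ)
    (cyc : ∀ i j k, J i j k = J j k i) (swap : ∀ i j k, J i j k = -J j i k)
    (incr : ∀ i j k, i < j → j < k → J i j k = 0) (i j k : ι) : J i j k = 0 := by
  have diag : ∀ a b, J a a b = 0 := fun a b => by linarith [swap a a b]
  rcases lt_trichotomy i j with hij | rfl | hij
  · rcases lt_trichotomy j k with hjk | rfl | hjk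
    · exact incr i j k hij hjk
    · rw [cyc, diag]
    · rcases lt_trichotomy i k with hik | rfl | hik
      · rw [cyc, cyc, swap, incr i k j hik hjk, neg_zero]
      · rw [cyc, cyc, diag]
      · rw [cyc, cyc, incr k i j hik hij]
  · exact diag i k
  · rcases lt_trichotomy i k with hik | rfl | hik
    · rw [swap, incr j i k hij hik, neg_zero]
    · rw [cyc, cyc, diag]
    · rcases lt_trichotomy j k with hjk | rfl | hjk
      · rw [cyc, incr j k i hjk hik]
      · rw [cyc, diag]
      · rw [swap, cyc, cyc, incr k j i hjk hij, neg_zero]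

set_option maxHeartbeats 1000000 in
/-- The pencil `P₁ − λ P₂` is a Poisson bivector for every `λ`: its components satisfy
the Jacobi identity. -/
theorem pencil_P₁_P₂_jacobi (c : ℝ) (hc : c ≠ 0) :
    ∀ (lam : ℝ) (m : Fin 6 → ℝ) (i j k : Fin 6),
      ∑ α, ((P₁ m - lam • P₂ c m) α i * pd α (fun y => (P₁ y - lam • P₂ c y) j k) m
        + (P₁ m - lam • P₂ c m) α j * pd α (fun y => (P₁ y - lam • P₂ c y) k i) m
        + (P₁ m - lam • P₂ c m) α k * pd α (fun y => (P₁ y - lam • P₂ c y) i j) m) = 0 := by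
  intro lam m
  refine eq_zero_of_alternating _ ?_ ?_ ?_
  · exact fun i j k => Finset.sum_congr rfl fun α _ => by ring
  · intro i j k
    rw [← Finset.sum_neg_distrib]
    refine Finset.sum_congr rfl fun α _ => ?_
    simp only [pd_pencil]
    rw [pencil_skew c lam (Pi.single α 1) j k, pencil_skew c lam 0 j k,
      pencil_skew c lam (Pi.single α 1) k i, pencil_skew c lam 0 k i,
      pencil_skew c lam (Pi.single α 1) i j, pencil_skew c lam 0 i j]
    ring
  · intro i j k hij hjk
    simp only [pd_pencil, Fin.sum_univ_six]
    fin_cases i <;> fin_cases j <;> first | exact absurd hij (by decide) | skip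
    all_goals fin_cases k <;> first | exact absurd hjk (by decide) | skip
    all_goals simp [P₁, P₂] <;> field_simp <;> ring
end
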